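/- Let d ≥ 0 be an integer, suppose ζ ∈ R is a primitive p^{d+1}-th root of unity, and let w ∈ W(R) be the Witt vector whose ghost components are ghost_i(w) = ζ^{p^i} − 1 for all i ≥ 0. Then: (i) F^{d+1}(w) = 0; (ii) for every x ∈ W(R) with F^{d+1}(x) = 0 there exists y ∈ W(R) with x = y·w; (iii) for y, y′ ∈ W(R) one has y·w = y′·w if and only if y − y′ ∈ V^{d+1}(W(R)). Consequently, multiplication by w induces an isomorphism of W(R)-modules from W(R)/V^{d+1}(W(R)) onto the kernel of F^{d+1} : W(R) → W(R); in particular this kernel is the principal ideal of W(R) generated by w. -/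

import Mathlib

section Helpers

open WittVector

variable {p : ℕ} [hp : Fact p.Prime] {K : Type*} [Field K]

/-- The ring of integers of a nonarchimedean absolute value. -/
def intRing (v : AbsoluteValue K ℝ) (hna : ∀ x y : K, v (x + y) ≤ max (v x) (v y)) :
    Subring K where
  carrier := {x | v x ≤ 1}
  mul_mem' := by
    intro a b ha hb
    simp only [Set.mem_ofPred_eq, map_mul] at *
    exact mul_le_one₀ ha (v.nonneg b) hb
  one_mem' := by simp
  add_mem' := by
    intro a b ha hb
    exact (hna a b).trans (max_le ha hb)
  zero_mem' := by simp
  neg_mem' := by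
    intro a ha
    simpa using ha

theorem mem_intRing {v : AbsoluteValue K ℝ} {hna : ∀ x y : K, v (x + y) ≤ max (v x) (v y)} {x : K} :
    x ∈ intRing v hna ↔ v x ≤ 1 := Iff.rfl

theorem int_iff (S : Subring K) (x : WittVector p K) :
    (∀ n, x.coeff n ∈ S) ↔ ∃ y : WittVector p S, WittVector.map S.subtype y = x := by
  constructor
  · intro h
    refine ⟨WittVector.mk p fun n => ⟨x.coeff n, h n⟩, ?_⟩
    ext n
    simp [WittVector.map_coeff]
  · rintro ⟨y, rfl⟩ n
    simp [WittVector.map_coeff]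

theorem int_frob (S : Subring K) (x : WittVector p K) (hx : ∀ n, x.coeff n ∈ S) (n : ℕ) :
    (frobenius x).coeff n ∈ S := by
  rw [coeff_frobenius, MvPolynomial.aeval_def, MvPolynomial.eval₂_eq]
  refine S.sum_mem fun i _ => S.mul_mem ?_ (S.prod_mem fun j _ => S.pow_mem (hx j) _)
  simp

theorem int_frob_iter (S : Subring K) (m : ℕ) (x : WittVector p K) (hx : ∀ n, x.coeff n ∈ S)
    (n : ℕ) : ((frobenius : WittVector p K → WittVector p K)^[m] x).coeff n ∈ S := by
  induction m generalizing n with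
  | zero => exact hx n
  | succ m ih => rw [Function.iterate_succ_apply']; exact int_frob S _ ih n

theorem int_mul (S : Subring K) (x y : WittVector p K) (hx : ∀ n, x.coeff n ∈ S)
    (hy : ∀ n, y.coeff n ∈ S) : ∀ n, (x * y).coeff n ∈ S := by
  rw [int_iff] at *
  obtain ⟨a, rfl⟩ := hx
  obtain ⟨b, rfl⟩ := hy
  exact ⟨a * b, by simp⟩

theorem int_add (S : Subring K) (x y : WittVector p K) (hx : ∀ n, x.coeff n ∈ S)
    (hy : ∀ n, y.coeff n ∈ S) : ∀ n, (x + y).coeff n ∈ S := by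
  rw [int_iff] at *
  obtain ⟨a, rfl⟩ := hx
  obtain ⟨b, rfl⟩ := hy
  exact ⟨a + b, by simp⟩

theorem int_sub (S : Subring K) (x y : WittVector p K) (hx : ∀ n, x.coeff n ∈ S)
    (hy : ∀ n, y.coeff n ∈ S) : ∀ n, (x - y).coeff n ∈ S := by
  rw [int_iff] at *
  obtain ⟨a, rfl⟩ := hx
  obtain ⟨b, rfl⟩ := hy
  exact ⟨a - b, by simp⟩

theorem ghost_sum (x : WittVector p K) (n : ℕ) :
    ghostComponent n x = ∑ i ∈ Finset.range (n + 1), (p : K) ^ i * x.coeff i ^ p ^ (n - i) := by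
  rw [ghostComponent_apply, aeval_wittPolynomial]

theorem ghost_frob_iter (m : ℕ) (x : WittVector p K) (n : ℕ) :
    ghostComponent n ((frobenius : WittVector p K → WittVector p K)^[m] x)
      = ghostComponent (n + m) x := by
  induction m generalizing n with
  | zero => rfl
  | succ m ih =>
    rw [Function.iterate_succ_apply', ghostComponent_frobenius, ih]
    congr 1
    congr 1
    omega

theorem coeff_zero_of_ghost [CharZero K] (x : WittVector p K) (m : ℕ)
    (h : ∀ i < m, ghostComponent i x = 0) : ∀ i < m, x.coeff i = 0 := by
  intro i
  induction i using Nat.strong_induction_on with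
  | _ i ih =>
    intro hi
    have h1 := h i hi
    rw [ghost_sum, Finset.sum_range_succ, Finset.sum_eq_zero] at h1
    · have : (p : K) ≠ 0 := by exact_mod_cast hp.out.ne_zero
      simpa [this] using h1
    · intro j hj
      rw [Finset.mem_range] at hj
      rw [ih j hj (hj.trans hi), zero_pow (pow_ne_zero _ hp.out.ne_zero), mul_zero]

theorem eq_zero_of_ghost [CharZero K] (x : WittVector p K)
    (h : ∀ i, ghostComponent i x = 0) : x = 0 := by
  ext i
  rw [zero_coeff]
  exact coeff_zero_of_ghost x (i + 1) (fun i _ => h i) i (Nat.lt_succ_self i)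

/-- Growth of the coefficients of a Witt vector killed by Frobenius. -/
theorem ker_frob_growth (v : AbsoluteValue K ℝ)
    (hna : ∀ x y : K, v (x + y) ≤ max (v x) (v y)) (hvp : v (p : K) = 1 / (p : ℝ))
    (u : WittVector p K) (hu : ∀ n, ghostComponent (n + 1) u = 0) (h0 : u.coeff 0 ≠ 0) (n : ℕ) :
    v (u.coeff (n + 1)) = p * v (u.coeff n) ^ p := by
  have hp0 : (0 : ℝ) < p := by exact_mod_cast hp.out.pos
  have hp1 : (1 : ℝ) < p := by exact_mod_cast hp.out.one_lt
  induction n using Nat.strong_induction_on with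
  | _ n ih =>
    have hpos : ∀ j ≤ n, 0 < v (u.coeff j) := by
      intro j
      induction j with
      | zero => intro _; exact v.pos h0
      | succ j ihj =>
        intro hj
        rw [ih j (by omega)]
        have := ihj (by omega)
        positivity
    have key : ∀ m ≤ n, v (∑ i ∈ Finset.range (m + 1), (p : K) ^ i * u.coeff i ^ p ^ (n + 1 - i))
        = v ((p : K) ^ m * u.coeff m ^ p ^ (n + 1 - m)) := by
      intro m
      induction m with
      | zero => intro _; simp
      | succ m ihm =>
        intro hm
        rw [Finset.sum_range_succ]
        apply IsNonarchimedean.add_eq_right_of_lt (f := v) hna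
        rw [ihm (by omega)]
        simp only [map_mul, map_pow, hvp]
        rw [ih m (by omega)]
        obtain ⟨k, rfl⟩ : ∃ k, n = m + 1 + k := ⟨n - (m + 1), by omega⟩
        have e1 : m + 1 + k + 1 - m = k + 1 + 1 := by omega
        have e2 : m + 1 + k + 1 - (m + 1) = k + 1 := by omega
        rw [e1, e2, mul_pow, ← pow_mul, ← pow_succ']
        have hA : 0 < v (u.coeff m) ^ p ^ (k + 1 + 1) := pow_pos (hpos m (by omega)) _
        have hB : (p : ℝ) < (p : ℝ) ^ p ^ (k + 1) := by
          conv_lhs => rw [← pow_one (p : ℝ)]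
          exact pow_lt_pow_right₀ hp1 (Nat.one_lt_pow (by omega) hp.out.one_lt)
        have hC : (0 : ℝ) < (1 / (p : ℝ)) ^ (m + 1) := by positivity
        have : (1 / (p : ℝ)) ^ m = (1 / (p : ℝ)) ^ (m + 1) * p := by
          rw [pow_succ]; field_simp
        rw [this, mul_assoc]
        gcongr
    have hg := hu n
    rw [ghost_sum, Finset.sum_range_succ] at hg
    have hk := key n le_rfl
    rw [eq_neg_of_add_eq_zero_left hg, v.map_neg] at hk
    simp only [map_mul, map_pow, hvp, Nat.sub_self, pow_zero, pow_one, Nat.add_sub_cancel_left]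
      at hk
    have hC : (0 : ℝ) < (1 / (p : ℝ)) ^ n := by positivity
    rw [pow_succ, mul_assoc] at hk
    have := mul_left_cancel₀ hC.ne' hk
    rw [← this]
    field_simp

theorem ker_frob_bound (v : AbsoluteValue K ℝ)
    (hna : ∀ x y : K, v (x + y) ≤ max (v x) (v y)) (hvp : v (p : K) = 1 / (p : ℝ))
    (u : WittVector p K) (hu : ∀ n, ghostComponent (n + 1) u = 0)
    (hint : ∀ n, v (u.coeff n) ≤ 1) : v (u.coeff 0) ^ (p - 1) ≤ 1 / p := by
  have hp0 : (0 : ℝ) < p := by exact_mod_cast hp.out.pos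
  have hp2 := hp.out.two_le
  by_cases h0 : u.coeff 0 = 0
  · rw [h0, map_zero, zero_pow (by omega)]
    positivity
  by_contra! hcon
  have hg := ker_frob_growth v hna hvp u hu h0
  have hr : ∀ n, (p : ℝ) * v (u.coeff n) ^ (p - 1) = (p * v (u.coeff 0) ^ (p - 1)) ^ p ^ n := by
    intro n
    induction n with
    | zero => simp
    | succ n ih =>
      rw [pow_succ, pow_mul, ← ih, hg n, mul_pow, mul_pow, ← pow_mul, ← pow_mul,
        mul_comm (p - 1) p, ← mul_assoc, ← pow_succ']
      congr 2
      omega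
  have h1 : 1 < (p : ℝ) * v (u.coeff 0) ^ (p - 1) := by
    rwa [div_lt_iff₀' hp0] at hcon
  obtain ⟨n, hn⟩ := pow_unbounded_of_one_lt (p : ℝ) h1
  have h2 : ((p : ℝ) * v (u.coeff 0) ^ (p - 1)) ^ n ≤ p := by
    calc _ ≤ ((p : ℝ) * v (u.coeff 0) ^ (p - 1)) ^ p ^ n :=
          pow_le_pow_right₀ h1.le (Nat.lt_pow_self hp.out.one_lt).le
      _ = _ := (hr n).symm
      _ ≤ p * 1 := by
          gcongr
          exact pow_le_one₀ (v.nonneg _) (hint n)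
      _ = p := mul_one _
  linarith

theorem zeta_bound (v : AbsoluteValue K ℝ)
    (hna : ∀ x y : K, v (x + y) ≤ max (v x) (v y)) (hvp : v (p : K) = 1 / (p : ℝ))
    (d : ℕ) (ζ : K) (hζR : v ζ ≤ 1) (hζ : IsPrimitiveRoot ζ (p ^ (d + 1))) :
    1 / (p : ℝ) ≤ v (ζ - 1) ^ (p ^ d * (p - 1)) := by
  have h1 : (p : K) = ∏ μ ∈ primitiveRoots (p ^ (d + 1)) K, (1 - μ) := by
    rw [← Polynomial.eval_one_cyclotomic_prime_pow (R := K) (p := p) d,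
      Polynomial.cyclotomic_eq_prod_X_sub_primitiveRoots hζ, Polynomial.eval_prod]
    simp
  rw [← hvp, h1, map_prod]
  have hc : (primitiveRoots (p ^ (d + 1)) K).card = p ^ d * (p - 1) := by
    rw [hζ.card_primitiveRoots, Nat.totient_prime_pow_succ hp.out]
  rw [← hc]
  rw [← Finset.prod_const]
  apply Finset.prod_le_prod
  · intro i _; exact v.nonneg _
  · intro μ hμ
    have hpos : 0 < p ^ (d + 1) := pow_pos hp.out.pos _
    rw [mem_primitiveRoots hpos] at hμ
    obtain ⟨i, _, rfl⟩ := hζ.eq_pow_of_pow_eq_one hμ.pow_eq_one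
    rw [v.map_sub, ← geom_sum_mul, map_mul]
    have : ∑ j ∈ Finset.range i, ζ ^ j ∈ intRing v hna :=
      Subring.sum_mem _ fun j _ => Subring.pow_mem _ (mem_intRing.2 hζR) j
    exact mul_le_of_le_one_left (v.nonneg _) this

theorem coeff_zero_bound [CharZero K] (v : AbsoluteValue K ℝ)
    (hna : ∀ x y : K, v (x + y) ≤ max (v x) (v y)) (hvp : v (p : K) = 1 / (p : ℝ))
    (d : ℕ) (x : WittVector p K) (hx : ∀ n, v (x.coeff n) ≤ 1)
    (hF : (frobenius : WittVector p K → WittVector p K)^[d + 1] x = 0) :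
    v (x.coeff 0) ^ (p ^ d * (p - 1)) ≤ 1 / p := by
  have hp2 := hp.out.two_le
  have hp0 : (0 : ℝ) < p := by exact_mod_cast hp.out.pos
  have hp1 : (1 : ℝ) < p := by exact_mod_cast hp.out.one_lt
  set u := (frobenius : WittVector p K → WittVector p K)^[d] x with hu
  have huint : ∀ n, v (u.coeff n) ≤ 1 := int_frob_iter (intRing v hna) d x hx
  have hb := ker_frob_bound v hna hvp u (by
    intro n
    rw [← ghostComponent_frobenius, hu, ← Function.iterate_succ_apply' (⇑WittVector.frobenius), hF, map_zero])
    huint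
  have hu0 : u.coeff 0 = ghostComponent d x := by
    have := ghost_frob_iter d x 0
    rw [← hu, ghost_sum, zero_add] at this
    simpa using this
  obtain ⟨t, ht, hxt⟩ : ∃ t : K, v t ≤ 1 ∧ x.coeff 0 ^ p ^ d = u.coeff 0 + p * t := by
    refine ⟨-∑ i ∈ Finset.range d, (p : K) ^ i * x.coeff (i + 1) ^ p ^ (d - (i + 1)), ?_, ?_⟩
    · rw [v.map_neg]
      have hh : ∑ i ∈ Finset.range d, (p : K) ^ i * x.coeff (i + 1) ^ p ^ (d - (i + 1))
          ∈ intRing v hna :=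
        Subring.sum_mem _ fun j _ => Subring.mul_mem _
          (Subring.pow_mem _ (natCast_mem _ p) j) (Subring.pow_mem _ (mem_intRing.2 (hx _)) _)
      exact hh
    · rw [hu0, ghost_sum, Finset.sum_range_succ', mul_neg, Finset.mul_sum]
      simp only [pow_succ', mul_assoc]
      simp
  rw [pow_mul, ← map_pow, hxt]
  have hmax : v (u.coeff 0 + p * t) ≤ max (v (u.coeff 0)) (1 / p) := by
    refine (hna _ _).trans (max_le_max le_rfl ?_)
    rw [map_mul, hvp]
    exact mul_le_of_le_one_right (by positivity) ht
  refine (pow_le_pow_left₀ (v.nonneg _) hmax _).trans ?_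
  rcases max_choice (v (u.coeff 0)) (1 / (p : ℝ)) with h | h
  · rw [h]; exact hb
  · rw [h]
    exact pow_le_of_le_one (by positivity) (by rw [div_le_one hp0]; exact hp1.le) (by omega)

theorem exists_quot [CharZero K] (v : AbsoluteValue K ℝ)
    (hna : ∀ x y : K, v (x + y) ≤ max (v x) (v y)) (hvp : v (p : K) = 1 / (p : ℝ))
    (m : ℕ) (ζ : K) (hζR : v ζ ≤ 1) (hζ : IsPrimitiveRoot ζ (p ^ m))
    (w : WittVector p K) (hw : ∀ i : ℕ, ghostComponent i w = ζ ^ (p ^ i) - 1)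
    (hwint : ∀ n : ℕ, v (w.coeff n) ≤ 1)
    (x : WittVector p K) (hx : ∀ n, v (x.coeff n) ≤ 1)
    (hF : (frobenius : WittVector p K → WittVector p K)^[m] x = 0) :
    ∃ y : WittVector p K, (∀ n, v (y.coeff n) ≤ 1) ∧ x = y * w := by
  induction m generalizing ζ w x with
  | zero =>
    refine ⟨0, by simp, ?_⟩
    simpa using hF
  | succ d ih =>
    have hp2 := hp.out.two_le
    have hpK : (p : K) ≠ 0 := by exact_mod_cast hp.out.ne_zero
    have hζ1 : ζ - 1 ≠ 0 := sub_ne_zero.2 (hζ.ne_one (Nat.one_lt_pow (by omega) hp.out.one_lt))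
    have hFw : ∀ i, ghostComponent (i + (d + 1)) w = 0 := by
      intro i
      rw [hw, add_comm, pow_add, pow_mul, hζ.pow_eq_one, one_pow, sub_self]
    have hle : v (x.coeff 0) ≤ v (ζ - 1) := by
      have h1 := (coeff_zero_bound v hna hvp d x hx hF).trans (zeta_bound v hna hvp d ζ hζR hζ)
      refine (pow_le_pow_iff_left₀ (v.nonneg _) (v.nonneg _) ?_).1 h1
      exact mul_ne_zero (pow_ne_zero _ hp.out.ne_zero) (by omega)
    set y0 := x.coeff 0 / (ζ - 1) with hy0
    have hy0int : v y0 ≤ 1 := by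
      rw [hy0, map_div₀]
      exact div_le_one_of_le₀ hle (v.nonneg _)
    have hT : ∀ n, v ((teichmuller p y0).coeff n) ≤ 1 := by
      intro n
      rcases Nat.eq_zero_or_pos n with rfl | h
      · rwa [teichmuller_coeff_zero]
      · rw [teichmuller_coeff_pos _ _ _ h]; simp
    set z := x - teichmuller p y0 * w with hz
    have hzint : ∀ n, v (z.coeff n) ≤ 1 :=
      int_sub (intRing v hna) _ _ hx (int_mul (intRing v hna) _ _ hT hwint)
    have hgx : ∀ i, ghostComponent (i + (d + 1)) x = 0 := by
      intro i
      rw [← ghost_frob_iter, hF, map_zero]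
    have hgz : ∀ i, ghostComponent (i + (d + 1)) z = 0 := by
      intro i
      rw [hz, map_sub, map_mul, hgx, hFw]; simp
    have hz0 : ∀ i < 1, z.coeff i = 0 := by
      apply coeff_zero_of_ghost
      intro i hi
      obtain rfl : i = 0 := by omega
      rw [hz, map_sub, map_mul, hw, ghostComponent_teichmuller, ghost_sum]
      simp [hy0, hζ1]
    have hzV : z = verschiebung (z.shift 1) := by
      have := eq_iterate_verschiebung hz0
      simpa using this
    obtain ⟨y', hy'int, hy'⟩ := ih (ζ ^ p) (by rw [map_pow]; exact pow_le_one₀ (v.nonneg _) hζR)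
      (hζ.pow (pow_pos hp.out.pos _) (pow_succ' p d)) (frobenius w)
      (by intro i; rw [ghostComponent_frobenius, hw, pow_succ', pow_mul])
      (int_frob (intRing v hna) w hwint) (z.shift 1)
      (by intro n; rw [shift_coeff]; exact hzint _)
      (by
        apply eq_zero_of_ghost
        intro i
        rw [ghost_frob_iter]
        have h1 := hgz i
        rw [hzV, ← add_assoc, ghostComponent_verschiebung] at h1
        exact (mul_eq_zero.1 h1).resolve_left hpK)
    refine ⟨teichmuller p y0 + verschiebung y', int_add (intRing v hna) _ _ hT ?_, ?_⟩
    · intro n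
      cases n with
      | zero => rw [verschiebung_coeff_zero]; exact Subring.zero_mem _
      | succ n => rw [verschiebung_coeff_succ]; exact hy'int n
    · rw [add_mul, ← verschiebung_mul_frobenius, ← hy', ← hzV, hz]
      ring

end Helpers


theorem statement_1 (p : ℕ) [Fact p.Prime] (K : Type*) [Field K] [CharZero K]
    (v : AbsoluteValue K ℝ)
    (hna : ∀ x y : K, v (x + y) ≤ max (v x) (v y))
    (hvp : v (p : K) = 1 / (p : ℝ))
    (d : ℕ) (ζ : K) (hζR : v ζ ≤ 1) (hζ : IsPrimitiveRoot ζ (p ^ (d + 1)))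
    (w : WittVector p K)
    (hw : ∀ i : ℕ, WittVector.ghostComponent i w = ζ ^ (p ^ i) - 1)
    (hwint : ∀ n : ℕ, v (w.coeff n) ≤ 1) :
    ((WittVector.frobenius : WittVector p K → WittVector p K)^[d + 1] w = 0)
    ∧ (∀ x : WittVector p K, (∀ n, v (x.coeff n) ≤ 1) →
        (WittVector.frobenius : WittVector p K → WittVector p K)^[d + 1] x = 0 →
        ∃ y : WittVector p K, (∀ n, v (y.coeff n) ≤ 1) ∧ x = y * w)
    ∧ (∀ y y' : WittVector p K, (∀ n, v (y.coeff n) ≤ 1) → (∀ n, v (y'.coeff n) ≤ 1) →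
        (y * w = y' * w ↔
          ∃ z : WittVector p K, (∀ n, v (z.coeff n) ≤ 1) ∧
            y - y' = (WittVector.verschiebung : WittVector p K → WittVector p K)^[d + 1] z)) := by
  have hFw : (WittVector.frobenius : WittVector p K → WittVector p K)^[d + 1] w = 0 := by
    apply eq_zero_of_ghost
    intro i
    rw [ghost_frob_iter, hw, add_comm, pow_add, pow_mul, hζ.pow_eq_one, one_pow, sub_self]
  refine ⟨hFw, ?_, ?_⟩
  · intro x hx hF
    exact exists_quot v hna hvp (d + 1) ζ hζR hζ w hw hwint x hx hF
  · intro y y' hy hy'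
    constructor
    · intro h
      refine ⟨(y - y').shift (d + 1), ?_, ?_⟩
      · intro n
        rw [WittVector.shift_coeff]
        exact int_sub (intRing v hna) y y' hy hy' _
      · apply WittVector.eq_iterate_verschiebung
        apply coeff_zero_of_ghost
        intro i hi
        have h1 : WittVector.ghostComponent i ((y - y') * w) = 0 := by
          rw [sub_mul, h, sub_self, map_zero]
        rw [map_mul, hw] at h1
        refine (mul_eq_zero.1 h1).resolve_right ?_
        refine sub_ne_zero.2 (hζ.pow_ne_one_of_pos_of_lt ?_ ?_)
        · exact pow_ne_zero _ (Fact.out : p.Prime).ne_zero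
        · exact Nat.pow_lt_pow_right (Fact.out : p.Prime).one_lt hi
    · rintro ⟨z, _, hz⟩
      rw [← sub_eq_zero, ← sub_mul, hz, WittVector.iterate_verschiebung_mul_left, hFw, mul_zero]
      exact Function.iterate_fixed (map_zero _) _
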